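/- (Theorem 1, space-domain part.) Let N_R, N_S, M be positive integers, let σ² > 0 and ρ > 0 be reals, and let G₁, …, G_M ∈ ℂ^{N_R×N_S} be arbitrary matrices. Define Σ_n = σ²·I_{N_R} + (ρ/N_S)·G_n G_n^* for n = 1, …, M (each Σ_n is Hermitian positive definite). Then the mutual information between a uniformly distributed index m ∈ {1, …, M} and the corresponding Gaussian mixture output, namely I = (1/M) Σ_{n=1}^M ∫_{ℂ^{N_R}} p_{Σ_n}(y) · log₂( p_{Σ_n}(y) / ((1/M) Σ_{t=1}^M p_{Σ_t}(y)) ) dy, satisfies the closed-form lower bound I ≥ log₂ M − N_R · log₂ e − (1/M) Σ_{n=1}^M log₂( Σ_{t=1}^M det Σ_n / det(Σ_n + Σ_t) ). -/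

import Mathlib

open MeasureTheory Matrix Real Filter
open scoped ComplexOrder

/-- The circularly symmetric complex Gaussian density
`p_Σ(y) = π^{-N} (det Σ)^{-1} exp(-y^* Σ^{-1} y)`. -/
noncomputable def gaussDensity {N : ℕ} (S : Matrix (Fin N) (Fin N) ℂ)
    (y : Fin N → ℂ) : ℝ :=
  (Real.pi ^ N)⁻¹ * (S.det.re)⁻¹ * Real.exp (-(star y ⬝ᵥ S⁻¹.mulVec y).re)

/-- The real quadratic form of a complex matrix. -/
noncomputable def qf {N : ℕ} (A : Matrix (Fin N) (Fin N) ℂ) (y : Fin N → ℂ) : ℝ :=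
  (star y ⬝ᵥ A.mulVec y).re

lemma qf_cont {N : ℕ} (A : Matrix (Fin N) (Fin N) ℂ) : Continuous (qf A) := by
  unfold qf
  simp only [dotProduct, Matrix.mulVec, Pi.star_apply]
  fun_prop

lemma std_gauss (N : ℕ) :
    Integrable (fun x : Fin N → ℂ => Real.exp (-∑ i, ‖x i‖ ^ 2)) ∧
    ∫ x : Fin N → ℂ, Real.exp (-∑ i, ‖x i‖ ^ 2) = π ^ N := by
  have h1 : ∫ v : ℂ, Real.exp (-‖v‖ ^ 2) = π := by
    have := GaussianFourier.integral_rexp_neg_mul_sq_norm (V := ℂ) (b := 1) one_pos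
    simpa using this
  have h2 : Integrable (fun v : ℂ => Real.exp (-‖v‖ ^ 2)) := by
    by_contra h
    rw [integral_undef h] at h1
    exact Real.pi_ne_zero h1.symm
  have e : (fun x : Fin N → ℂ => Real.exp (-∑ i, ‖x i‖ ^ 2))
      = fun x => ∏ i, Real.exp (-‖x i‖ ^ 2) := by
    funext x
    rw [← Real.exp_sum, Finset.sum_neg_distrib]
  rw [e]
  constructor
  · exact Integrable.fintype_prod (f := fun _ v => Real.exp (-‖v‖ ^ 2)) (fun _ => h2)
  · rw [integral_fintype_prod_volume_eq_prod (fun _ (v : ℂ) => Real.exp (-‖v‖ ^ 2))]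
    simp [h1]

lemma det_re_pos {N : ℕ} {A : Matrix (Fin N) (Fin N) ℂ} (hA : A.PosDef) : 0 < A.det.re :=
  (Complex.pos_iff.1 hA.det_pos).1

lemma det_eq {N : ℕ} {A : Matrix (Fin N) (Fin N) ℂ} (hA : A.PosDef) :
    A.det = (A.det.re : ℂ) := by
  apply Complex.ext
  · simp
  · simpa using (Complex.pos_iff.1 hA.det_pos).2.symm

open MatrixOrder in
lemma exists_factor {N : ℕ} {A : Matrix (Fin N) (Fin N) ℂ} (hA : A.PosDef) :
    ∃ B : Matrix (Fin N) (Fin N) ℂ, IsUnit B ∧ A = Bᴴ * B := by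
  have := CStarAlgebra.isStrictlyPositive_iff_eq_star_mul_self.1
    (Matrix.isStrictlyPositive_iff_posDef.2 hA)
  exact this

lemma key {N : ℕ} {A : Matrix (Fin N) (Fin N) ℂ} (hA : A.PosDef) :
    Integrable (fun y => Real.exp (-qf A y)) ∧
    ∫ y, Real.exp (-qf A y) = π ^ N / A.det.re := by
  obtain ⟨B, hB, rfl⟩ := exists_factor hA
  have hBd : B.det ≠ 0 := ((Matrix.isUnit_iff_isUnit_det B).1 hB).ne_zero
  have hdet : (Bᴴ * B).det.re = Complex.normSq B.det := by
    rw [Matrix.det_mul, Matrix.det_conjTranspose, Complex.star_def, ← Complex.normSq_eq_conj_mul_self]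
    simp
  have hpos : 0 < Complex.normSq B.det := Complex.normSq_pos.2 hBd
  let f : (Fin N → ℂ) →ₗ[ℝ] (Fin N → ℂ) := (Matrix.toLin' B).restrictScalars ℝ
  have hf : LinearMap.det f = Complex.normSq B.det := by
    rw [LinearMap.det_restrictScalars, Algebra.norm_complex_apply, LinearMap.det_toLin']
  have hf0 : LinearMap.det f ≠ 0 := by rw [hf]; exact hpos.ne'
  have hfc : Continuous f := f.continuous_of_finiteDimensional
  have hmap := Measure.map_linearMap_addHaar_eq_smul_addHaar
    (volume : Measure (Fin N → ℂ)) hf0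
  have hq : ∀ y, qf (Bᴴ * B) y = ∑ i, ‖f y i‖ ^ 2 := by
    intro y
    have : f y = B *ᵥ y := rfl
    rw [this]
    unfold qf
    rw [← Matrix.mulVec_mulVec, Matrix.dotProduct_mulVec, ← Matrix.star_mulVec]
    simp only [dotProduct, Pi.star_apply, Complex.re_sum, Complex.star_def,
      ← Complex.normSq_eq_conj_mul_self, Complex.ofReal_re, Complex.normSq_eq_norm_sq]
  obtain ⟨g1, g2⟩ := std_gauss N
  set g : (Fin N → ℂ) → ℝ := fun x => Real.exp (-∑ i, ‖x i‖ ^ 2) with hg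
  have e : (fun y => Real.exp (-qf (Bᴴ * B) y)) = fun y => g (f y) := by
    funext y; rw [hq]
  have hgm : AEStronglyMeasurable g (Measure.map f volume) := by
    apply Continuous.aestronglyMeasurable
    fun_prop
  rw [e, hdet]
  constructor
  · refine (integrable_map_measure hgm hfc.aemeasurable).1 ?_
    rw [hmap]
    exact g1.smul_measure ENNReal.ofReal_ne_top
  · rw [← integral_map hfc.aemeasurable hgm, hmap, integral_smul_measure, g2, hf,
      ENNReal.toReal_ofReal (abs_nonneg _), abs_of_pos (inv_pos.2 hpos), smul_eq_mul]
    field_simp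

lemma qf_nonneg {N : ℕ} {A : Matrix (Fin N) (Fin N) ℂ} (hA : A.PosDef) (y) : 0 ≤ qf A y :=
  hA.posSemidef.re_dotProduct_nonneg y

lemma key_scaled {N : ℕ} {A : Matrix (Fin N) (Fin N) ℂ} (hA : A.PosDef) {c : ℝ} (hc : 0 < c) :
    Integrable (fun y => Real.exp (-(c * qf A y))) ∧
    ∫ y, Real.exp (-(c * qf A y)) = π ^ N / A.det.re / c ^ N := by
  have hcA : (c • A).PosDef := hA.smul hc
  have := key hcA
  have hq : ∀ y, qf (c • A) y = c * qf A y := by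
    intro y
    simp [qf, Matrix.smul_mulVec, dotProduct_smul]
  have hd : (c • A).det.re = c ^ N * A.det.re := by
    have : c • A = (c : ℂ) • A := by ext; simp
    rw [this, Matrix.det_smul, det_eq hA, ← Complex.ofReal_pow, ← Complex.ofReal_mul]
    simp only [Complex.ofReal_re, Fintype.card_fin]
  simp only [hq, hd] at this
  refine ⟨this.1, this.2.trans ?_⟩
  rw [mul_comm, div_div]

lemma pt_bound (q ε : ℝ) : ε * (q * Real.exp (-q)) ≤ Real.exp (-((1 - ε) * q)) - Real.exp (-q) := by
  have h : Real.exp (-((1 - ε) * q)) = Real.exp (-q) * Real.exp (ε * q) := by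
    rw [← Real.exp_add]; ring_nf
  rw [h]
  nlinarith [Real.add_one_le_exp (ε * q), Real.exp_pos (-q)]

lemma moment {N : ℕ} {A : Matrix (Fin N) (Fin N) ℂ} (hA : A.PosDef) :
    Integrable (fun y => qf A y * Real.exp (-qf A y)) ∧
    ∫ y, qf A y * Real.exp (-qf A y) ≤ N * (π ^ N / A.det.re) := by
  obtain ⟨k1, k2⟩ := key hA
  have hcont := qf_cont A
  have hint : Integrable (fun y => qf A y * Real.exp (-qf A y)) := by
    have h2 := (key_scaled hA (c := 1 / 2) (by norm_num)).1
    refine (h2.const_mul 2).mono' (by apply Continuous.aestronglyMeasurable; fun_prop) ?_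
    refine Eventually.of_forall fun y => ?_
    rw [Real.norm_of_nonneg (mul_nonneg (qf_nonneg hA y) (Real.exp_pos _).le)]
    have := pt_bound (qf A y) (1 / 2)
    have h3 := Real.exp_pos (-qf A y)
    norm_num at this ⊢
    linarith
  refine ⟨hint, ?_⟩
  set J := ∫ y, qf A y * Real.exp (-qf A y) with hJ
  set K := π ^ N / A.det.re with hK
  have hKpos : 0 < K := div_pos (by positivity) (det_re_pos hA)
  have main : ∀ ε : ℝ, 0 < ε → ε < 1 → J * (1 - ε) ^ N ≤ N * K := by
    intro ε h0 h1
    obtain ⟨s1, s2⟩ := key_scaled hA (c := 1 - ε) (by linarith)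
    have hle : ∫ y, ε * (qf A y * Real.exp (-qf A y)) ≤
        ∫ y, (Real.exp (-((1 - ε) * qf A y)) - Real.exp (-qf A y)) :=
      integral_mono (hint.const_mul ε) (s1.sub k1) (fun y => pt_bound _ _)
    rw [integral_const_mul, integral_sub s1 k1, s2, k2, ← hJ, ← hK] at hle
    have hp : 0 < (1 - ε) ^ N := pow_pos (by linarith) N
    have hb : 1 + (N : ℝ) * (-ε) ≤ (1 + (-ε)) ^ N := one_add_mul_le_pow (by linarith) N
    rw [← sub_eq_add_neg] at hb
    have h4 : ε * J * (1 - ε) ^ N ≤ K - K * (1 - ε) ^ N := by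
      have := mul_le_mul_of_nonneg_right hle hp.le
      rwa [sub_mul, div_mul_cancel₀ _ hp.ne'] at this
    have h5 : ε * (J * (1 - ε) ^ N) ≤ ε * (N * K) := by nlinarith
    exact le_of_mul_le_mul_left h5 h0
  have ht : Tendsto (fun ε : ℝ => J * (1 - ε) ^ N) (nhdsWithin 0 (Set.Ioi 0)) (nhds (J * (1 - 0) ^ N)) := by
    apply Tendsto.mono_left _ nhdsWithin_le_nhds
    apply Continuous.tendsto
    fun_prop
  have := le_of_tendsto ht (b := N * K) (by
    filter_upwards [Ioo_mem_nhdsGT (show (0 : ℝ) < 1 by norm_num)] with ε hε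
    exact main ε hε.1 hε.2)
  simpa using this

lemma gd_eq {N : ℕ} (S : Matrix (Fin N) (Fin N) ℂ) (y : Fin N → ℂ) :
    gaussDensity S y = ((π ^ N)⁻¹ * (S.det.re)⁻¹) * Real.exp (-qf S⁻¹ y) := rfl

lemma gd_const_pos {N : ℕ} {S : Matrix (Fin N) (Fin N) ℂ} (hS : S.PosDef) :
    0 < (π ^ N)⁻¹ * (S.det.re)⁻¹ := by
  have := det_re_pos hS
  positivity

lemma gd_pos {N : ℕ} {S : Matrix (Fin N) (Fin N) ℂ} (hS : S.PosDef) (y : Fin N → ℂ) :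
    0 < gaussDensity S y := by
  rw [gd_eq]
  exact mul_pos (gd_const_pos hS) (Real.exp_pos _)

lemma gd_cont {N : ℕ} (S : Matrix (Fin N) (Fin N) ℂ) : Continuous (gaussDensity S) := by
  have := qf_cont S⁻¹
  have e : gaussDensity S = fun y => ((π ^ N)⁻¹ * (S.det.re)⁻¹) * Real.exp (-qf S⁻¹ y) := rfl
  rw [e]
  fun_prop

lemma det_inv_re {N : ℕ} {S : Matrix (Fin N) (Fin N) ℂ} (hS : S.PosDef) :
    S⁻¹.det.re = (S.det.re)⁻¹ := by
  rw [Matrix.det_nonsing_inv, Ring.inverse_eq_inv', det_eq hS, ← Complex.ofReal_inv,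
    Complex.ofReal_re, Complex.ofReal_re]

lemma gd_int {N : ℕ} {S : Matrix (Fin N) (Fin N) ℂ} (hS : S.PosDef) :
    Integrable (gaussDensity S) ∧ ∫ y, gaussDensity S y = 1 := by
  obtain ⟨k1, k2⟩ := key hS.inv
  have h := det_re_pos hS
  refine ⟨k1.const_mul _, ?_⟩
  simp only [gd_eq]
  rw [integral_const_mul, k2, det_inv_re hS]
  field_simp

lemma gd_mom {N : ℕ} {S : Matrix (Fin N) (Fin N) ℂ} (hS : S.PosDef) :
    Integrable (fun y => gaussDensity S y * qf S⁻¹ y) ∧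
    ∫ y, gaussDensity S y * qf S⁻¹ y ≤ N := by
  obtain ⟨k1, k2⟩ := moment hS.inv
  have h := det_re_pos hS
  have e : (fun y => gaussDensity S y * qf S⁻¹ y) = fun y =>
      ((π ^ N)⁻¹ * (S.det.re)⁻¹) * (qf S⁻¹ y * Real.exp (-qf S⁻¹ y)) := by
    funext y; rw [gd_eq]; ring
  rw [e]
  refine ⟨k1.const_mul _, ?_⟩
  rw [integral_const_mul]
  refine (mul_le_mul_of_nonneg_left k2 (gd_const_pos hS).le).trans (le_of_eq ?_)
  rw [det_inv_re hS]
  field_simp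

lemma det_inv_add_inv {N : ℕ} {S T : Matrix (Fin N) (Fin N) ℂ} (hS : S.PosDef) (hT : T.PosDef) :
    (S⁻¹ + T⁻¹).det.re = (S.det.re)⁻¹ * (S + T).det.re * (T.det.re)⁻¹ := by
  have hSu : IsUnit S.det := hS.det_pos.ne'.isUnit
  have hTu : IsUnit T.det := hT.det_pos.ne'.isUnit
  have e : S⁻¹ + T⁻¹ = S⁻¹ * (S + T) * T⁻¹ := by
    rw [Matrix.mul_add, Matrix.nonsing_inv_mul _ hSu, Matrix.add_mul, Matrix.one_mul,
      Matrix.mul_assoc, Matrix.mul_nonsing_inv _ hTu, Matrix.mul_one, add_comm]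
  rw [e, Matrix.det_mul, Matrix.det_mul, det_eq hS.inv, det_eq hT.inv, det_eq (hS.add hT),
    ← Complex.ofReal_mul, ← Complex.ofReal_mul]
  simp only [Complex.ofReal_re, det_inv_re hS, det_inv_re hT]

lemma gd_mul_int {N : ℕ} {S T : Matrix (Fin N) (Fin N) ℂ} (hS : S.PosDef) (hT : T.PosDef) :
    Integrable (fun y => gaussDensity S y * gaussDensity T y) ∧
    ∫ y, gaussDensity S y * gaussDensity T y = (π ^ N)⁻¹ / (S + T).det.re := by
  obtain ⟨k1, k2⟩ := key (hS.inv.add hT.inv)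
  have h1 := det_re_pos hS
  have h2 := det_re_pos hT
  have h3 := det_re_pos (hS.add hT)
  have e : (fun y => gaussDensity S y * gaussDensity T y) = fun y =>
      (((π ^ N)⁻¹ * (S.det.re)⁻¹) * ((π ^ N)⁻¹ * (T.det.re)⁻¹)) *
        Real.exp (-qf (S⁻¹ + T⁻¹) y) := by
    funext y
    have : qf (S⁻¹ + T⁻¹) y = qf S⁻¹ y + qf T⁻¹ y := by
      simp [qf, Matrix.add_mulVec, dotProduct_add]
    rw [gd_eq, gd_eq, this, neg_add, Real.exp_add]; ring
  rw [e]
  refine ⟨k1.const_mul _, ?_⟩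
  rw [integral_const_mul, k2, det_inv_add_inv hS hT]
  field_simp

lemma per_index {N M : ℕ} (hM : 0 < M) (Sig : Fin M → Matrix (Fin N) (Fin N) ℂ)
    (hS : ∀ n, (Sig n).PosDef) (n : Fin M) :
    Real.log M - N - Real.log (∑ t, (Sig n).det.re / (Sig n + Sig t).det.re) ≤
    ∫ y, gaussDensity (Sig n) y * Real.log (gaussDensity (Sig n) y /
      ((1 / (M : ℝ)) * ∑ t, gaussDensity (Sig t) y)) := by
  have hM' : (0 : ℝ) < M := by exact_mod_cast hM
  have hne : (Finset.univ : Finset (Fin M)).Nonempty := ⟨n, Finset.mem_univ n⟩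
  have hdn := det_re_pos (hS n)
  set p := gaussDensity (Sig n) with hp
  set q := qf (Sig n)⁻¹ with hq
  set s : (Fin N → ℂ) → ℝ := fun y => ∑ t, gaussDensity (Sig t) y with hs
  set c : ℝ := (π ^ N)⁻¹ * ((Sig n).det.re)⁻¹ with hc
  have hcpos : 0 < c := gd_const_pos (hS n)
  set C : ℝ := ∑ t, (π ^ N)⁻¹ / (Sig n + Sig t).det.re with hC
  have hCpos : 0 < C := Finset.sum_pos
    (fun t _ => div_pos (by positivity) (det_re_pos ((hS n).add (hS t)))) hne
  have hsum : ∑ t, (Sig n).det.re / (Sig n + Sig t).det.re = C / c := by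
    rw [hC, Finset.sum_div]
    refine Finset.sum_congr rfl fun t _ => ?_
    have := det_re_pos ((hS n).add (hS t))
    rw [hc]
    field_simp
  have hppos : ∀ y, 0 < p y := fun y => gd_pos (hS n) y
  have hspos : ∀ y, 0 < s y := fun y => Finset.sum_pos (fun t _ => gd_pos (hS t) y) hne
  have hps : ∀ y, p y ≤ s y := fun y =>
    Finset.single_le_sum (f := fun t => gaussDensity (Sig t) y)
      (fun t _ => (gd_pos (hS t) y).le) (Finset.mem_univ n)
  obtain ⟨ip, vp⟩ := gd_int (hS n)
  obtain ⟨iq, vq⟩ := gd_mom (hS n)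
  have ips : Integrable (fun y => p y * s y) := by
    simp only [hs, Finset.mul_sum]
    exact integrable_finsetSum _ fun t _ => (gd_mul_int (hS n) (hS t)).1
  have vps : ∫ y, p y * s y = C := by
    simp only [hs, Finset.mul_sum]
    rw [integral_finsetSum _ fun t _ => (gd_mul_int (hS n) (hS t)).1]
    exact Finset.sum_congr rfl fun t _ => (gd_mul_int (hS n) (hS t)).2
  have hlog : ∀ y, Real.log (p y / (1 / (M : ℝ) * s y)) =
      Real.log M + Real.log c - q y - Real.log (s y) := by
    intro y
    have h1 : Real.log (p y) = Real.log c - q y := by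
      rw [hp, gd_eq, Real.log_mul hcpos.ne' (Real.exp_pos _).ne', Real.log_exp]; rfl
    rw [Real.log_div (hppos y).ne' (mul_pos (by positivity) (hspos y)).ne',
      Real.log_mul (by positivity) (hspos y).ne', h1, one_div, Real.log_inv]
    ring
  set a : ℝ := Real.log M + Real.log c - Real.log C + 1 with ha
  have iL : Integrable (fun y => a * p y - p y * q y - C⁻¹ * (p y * s y)) :=
    ((ip.const_mul a).sub iq).sub (ips.const_mul C⁻¹)
  have hlow : ∀ y, a * p y - p y * q y - C⁻¹ * (p y * s y) ≤
      p y * Real.log (p y / (1 / (M : ℝ) * s y)) := by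
    intro y
    rw [hlog]
    have h1 : Real.log (s y) ≤ Real.log C + C⁻¹ * s y - 1 := by
      have := Real.log_le_sub_one_of_pos (mul_pos (inv_pos.2 hCpos) (hspos y))
      rw [Real.log_mul (inv_pos.2 hCpos).ne' (hspos y).ne', Real.log_inv] at this
      linarith
    have := mul_le_mul_of_nonneg_left h1 (hppos y).le
    rw [ha]
    nlinarith
  have hup : ∀ y, p y * Real.log (p y / (1 / (M : ℝ) * s y)) ≤ Real.log M * p y := by
    intro y
    rw [mul_comm (Real.log M)]
    refine mul_le_mul_of_nonneg_left ?_ (hppos y).le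
    apply Real.log_le_log (div_pos (hppos y) (mul_pos (by positivity) (hspos y)))
    rw [div_le_iff₀ (mul_pos (by positivity) (hspos y))]
    have : (M : ℝ) * (1 / M * s y) = s y := by field_simp
    rw [this]
    exact hps y
  have hmeas : AEStronglyMeasurable (fun y => p y * Real.log (p y / (1 / (M : ℝ) * s y))) volume := by
    have h1 : Measurable p := (gd_cont _).measurable
    have h2 : Measurable s := Finset.measurable_fun_sum _ fun t _ => (gd_cont (Sig t)).measurable
    exact (h1.mul (h1.div (h2.const_mul _)).log).aestronglyMeasurable
  have iI : Integrable (fun y => p y * Real.log (p y / (1 / (M : ℝ) * s y))) :=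
    integrable_of_le_of_le hmeas (Eventually.of_forall hlow) (Eventually.of_forall hup) iL
      (ip.const_mul _)
  have hmono := integral_mono iL iI hlow
  have e1 : ∫ y, (a * p y - p y * q y - C⁻¹ * (p y * s y)) =
      a * 1 - (∫ y, p y * q y) - C⁻¹ * C := by
    have j1 : Integrable (fun y => a * p y) := ip.const_mul a
    have j2 : Integrable (fun y => p y * q y) := iq
    have j3 : Integrable (fun y => a * p y - p y * q y) := j1.sub j2
    rw [integral_sub j3 (ips.const_mul C⁻¹),
      integral_sub j1 j2, integral_const_mul, integral_const_mul, vps, vp]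
  rw [e1, inv_mul_cancel₀ hCpos.ne'] at hmono
  rw [hsum, Real.log_div hCpos.ne' hcpos.ne']
  linarith

/-- Theorem 1, space-domain part: with
`Σ_n = σ²·I + (ρ/N_S)·G_n G_n^*`, the mutual information between a
uniformly distributed index `m ∈ {1,…,M}` and the corresponding Gaussian
mixture output satisfies the closed-form lower bound
`I ≥ log₂ M − N_R·log₂ e − (1/M)·Σ_n log₂(Σ_t det Σ_n / det(Σ_n + Σ_t))`. -/
theorem space_domain_MI_lower_bound (NR NS M : ℕ)
    (hNR : 0 < NR) (hNS : 0 < NS) (hM : 0 < M)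
    (σ2 ρ : ℝ) (hσ2 : 0 < σ2) (hρ : 0 < ρ)
    (G : Fin M → Matrix (Fin NR) (Fin NS) ℂ)
    (Sig : Fin M → Matrix (Fin NR) (Fin NR) ℂ)
    (hSig : ∀ n, Sig n = σ2 • (1 : Matrix (Fin NR) (Fin NR) ℂ)
        + (ρ / (NS : ℝ)) • (G n * (G n)ᴴ)) :
    (1 / (M : ℝ)) * ∑ n, (∫ y : Fin NR → ℂ,
        gaussDensity (Sig n) y *
          Real.logb 2 (gaussDensity (Sig n) y /
            ((1 / (M : ℝ)) * ∑ t, gaussDensity (Sig t) y)))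
      ≥ Real.logb 2 M - (NR : ℝ) * Real.logb 2 (Real.exp 1)
          - (1 / (M : ℝ)) * ∑ n, Real.logb 2
              (∑ t, (Sig n).det.re / ((Sig n) + (Sig t)).det.re) := by
  have hS : ∀ n, (Sig n).PosDef := by
    intro n
    rw [hSig n]
    exact (PosDef.one.smul hσ2).add_posSemidef
      ((posSemidef_self_mul_conjTranspose (G n)).smul (by positivity))
  have hM' : (0 : ℝ) < M := by exact_mod_cast hM
  have hl2 : 0 < Real.log 2 := Real.log_pos (by norm_num)
  have hn : ∀ n, Real.logb 2 M - (NR : ℝ) * Real.logb 2 (Real.exp 1) - Real.logb 2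
      (∑ t, (Sig n).det.re / ((Sig n) + (Sig t)).det.re) ≤ ∫ y : Fin NR → ℂ,
        gaussDensity (Sig n) y *
          Real.logb 2 (gaussDensity (Sig n) y /
            ((1 / (M : ℝ)) * ∑ t, gaussDensity (Sig t) y)) := by
    intro n
    have h := per_index hM Sig hS n
    simp only [Real.logb, Real.log_exp, ← mul_div_assoc]
    rw [integral_div, mul_one, ← sub_div, ← sub_div]
    exact div_le_div_of_nonneg_right h hl2.le
  have hsum := Finset.sum_le_sum fun n (_ : n ∈ Finset.univ) => hn n
  have h2 := mul_le_mul_of_nonneg_left hsum (show 0 ≤ 1 / (M : ℝ) by positivity)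
  refine ge_iff_le.2 (le_trans (le_of_eq ?_) h2)
  rw [Finset.sum_sub_distrib, Finset.sum_const, Finset.card_univ, Fintype.card_fin, nsmul_eq_mul]
  field_simp
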